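/- Let p be an odd prime and G a non-abelian group whose order is p⁴ or p⁵, having a subgroup of order p not contained in the center Z(G), with |Z(G)| = p, and such that the transiso graph Γ_p(G) is complete. Then the Frattini subgroup Φ(G) equals the center Z(G). -/

import Mathlib

/-- `S` is a normalized right transversal (NRT) of `H` in `G`: `1 ∈ S` and every `g ∈ G`
is uniquely `h * s` with `h ∈ H`, `s ∈ S`. -/
def IsNRT {G : Type*} [Group G] (H : Subgroup G) (S : Set G) : Prop :=
  (1 : G) ∈ S ∧ ∀ g : G, ∃! s, s ∈ S ∧ ∃ h ∈ H, g = h * s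

/-- `φ` is an isomorphism of NRTs from `S₁` (an NRT of `H₁`) onto `S₂` (an NRT of `H₂`):
it is a bijection from `S₁` to `S₂` carrying the induced operation of `S₁` to that of `S₂`,
where `z = x ∘ y` in `S` means `z ∈ S` and `x * y ∈ H * z`. -/
def IsNRTIso {G : Type*} [Group G] (H₁ H₂ : Subgroup G) (S₁ S₂ : Set G) (φ : G → G) : Prop :=
  Set.BijOn φ S₁ S₂ ∧
    ∀ x ∈ S₁, ∀ y ∈ S₁, ∀ z ∈ S₁, (∃ h ∈ H₁, x * y = h * z) →
      ∃ h ∈ H₂, φ x * φ y = h * φ z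

/-- Two subgroups are adjacent in the transiso graph if they admit isomorphic NRTs. -/
def TransisoAdj {G : Type*} [Group G] (H₁ H₂ : Subgroup G) : Prop :=
  ∃ S₁ S₂ : Set G, IsNRT H₁ S₁ ∧ IsNRT H₂ S₂ ∧ ∃ φ : G → G, IsNRTIso H₁ H₂ S₁ S₂ φ

/-- The transiso graph `Γ_d(G)` is complete: any two distinct subgroups of order `d`
are adjacent. -/
def TransisoComplete (G : Type*) [Group G] (d : ℕ) : Prop :=
  ∀ H₁ H₂ : Subgroup G, Nat.card H₁ = d → Nat.card H₂ = d → H₁ ≠ H₂ →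
    TransisoAdj H₁ H₂

section PGroup

variable {G : Type*} [Group G] {p : ℕ}

theorem IsPGroup.eq_one_of_zpow_one_add_mul (hG : IsPGroup p G) (hp : p.Prime) {g : G} {t : ℤ}
    (h : g ^ (1 + p * t) = 1) : g = 1 := by
  have := Fact.mk hp
  by_contra hg
  have h1 : (p : ℤ) ∣ 1 + p * t :=
    (Int.natCast_dvd_natCast.2 (hG.dvd_orderOf hg)).trans (orderOf_dvd_iff_zpow_eq_one.2 h)
  have h2 : (p : ℤ) ∣ 1 := (dvd_add_left (dvd_mul_right _ _)).1 h1
  exact (Nat.prime_iff_prime_int.1 hp).not_dvd_one h2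

theorem exists_geom_sum_eq_mul_one_add_mul (hodd : Odd p) {a : ℤ} (ha : (p : ℤ) ∣ a - 1) :
    ∃ t : ℤ, ∑ i ∈ Finset.range p, a ^ i = p * (1 + p * t) := by
  obtain ⟨k, hk⟩ := ha
  obtain ⟨t, ht⟩ := odd_sq_dvd_geom_sum₂_sub (R := ℤ) (a := 1) (b := k) hodd
  refine ⟨t, ?_⟩
  have h : a = 1 + p * k := by linarith
  simp only [one_pow, mul_one] at ht
  rw [h]
  linear_combination ht

/-- Powers coprime to `p` generate the same cyclic subgroup of a `p`-group. -/
theorem IsPGroup.mem_zpowers_zpow (hG : IsPGroup p G) (hp : p.Prime) {k : ℤ}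
    (hk : ¬ (p : ℤ) ∣ k) (c : G) : c ∈ Subgroup.zpowers (c ^ k) := by
  obtain ⟨n, hn⟩ := hG c
  have hco : IsCoprime k ((p : ℤ) ^ n) :=
    (((Nat.prime_iff_prime_int.1 hp).coprime_iff_not_dvd.2 hk).symm).pow_right
  obtain ⟨u, v, huv⟩ := hco
  refine Subgroup.mem_zpowers_iff.2 ⟨u, ?_⟩
  have h1 : c ^ ((p : ℤ) ^ n) = 1 := by exact_mod_cast hn
  calc (c ^ k) ^ u = c ^ (u * k + v * (p : ℤ) ^ n) := by
        rw [zpow_add, mul_comm v, zpow_mul c _ v, h1, one_zpow, mul_one, mul_comm, zpow_mul]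
    _ = c := by rw [huv, zpow_one]

theorem Subgroup.mem_of_zpow_mem_of_pow_mem (hp : p.Prime) {L : Subgroup G} {x : G} {k : ℤ}
    (hk : ¬ (p : ℤ) ∣ k) (hxk : x ^ k ∈ L) (hxp : x ^ p ∈ L) : x ∈ L := by
  obtain ⟨u, v, huv⟩ := (Nat.prime_iff_prime_int.1 hp).coprime_iff_not_dvd.2 hk
  have h : x = (x ^ p) ^ u * (x ^ k) ^ v := by
    rw [← zpow_natCast x p, ← zpow_mul, ← zpow_mul, ← zpow_add, mul_comm (p : ℤ), mul_comm k, huv,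
      zpow_one]
  rw [h]
  exact L.mul_mem (L.zpow_mem hxp _) (L.zpow_mem hxk _)

theorem pow_mul_zpow_mul_inv_of_conj_eq_zpow {c y : G} {a : ℤ} (h : y * c * y⁻¹ = c ^ a)
    (n : ℕ) (k : ℤ) : y ^ n * c ^ k * (y ^ n)⁻¹ = c ^ (k * a ^ n) := by
  induction n with
  | zero => simp
  | succ n ih =>
    calc y ^ (n + 1) * c ^ k * (y ^ (n + 1))⁻¹
        = y * (y ^ n * c ^ k * (y ^ n)⁻¹) * y⁻¹ := by rw [pow_succ' y]; group
      _ = (y * c * y⁻¹) ^ (k * a ^ n) := by rw [ih, conj_zpow]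
      _ = c ^ (k * a ^ (n + 1)) := by rw [h, ← zpow_mul]; ring_nf

theorem zpow_mul_pow_of_conj_eq_zpow {c y : G} {a : ℤ} (h : y * c * y⁻¹ = c ^ a) (k : ℤ) (n : ℕ) :
    (c ^ k * y) ^ n = c ^ (k * ∑ i ∈ Finset.range n, a ^ i) * y ^ n := by
  induction n with
  | zero => simp
  | succ n ih =>
    have h1 := pow_mul_zpow_mul_inv_of_conj_eq_zpow h n k
    rw [pow_succ, ih, Finset.sum_range_succ, mul_add, zpow_add, ← h1, pow_succ]
    group

theorem IsPGroup.dvd_sub_one_of_conj_eq_zpow (hG : IsPGroup p G) (hp : p.Prime) {c y : G} {a : ℤ}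
    (h : y * c * y⁻¹ = c ^ a) (hc : c ≠ 1) : (p : ℤ) ∣ a - 1 := by
  have := Fact.mk hp
  obtain ⟨n, hn⟩ := hG y
  have h1 := pow_mul_zpow_mul_inv_of_conj_eq_zpow h (p ^ n) 1
  rw [hn] at h1
  have h2 : c ^ (a ^ p ^ n - 1) = 1 := by
    rw [zpow_sub, zpow_one]
    simpa [mul_inv_eq_one] using h1.symm
  have h3 : (p : ℤ) ∣ a ^ p ^ n - 1 :=
    (Int.natCast_dvd_natCast.2 (hG.dvd_orderOf hc)).trans (orderOf_dvd_iff_zpow_eq_one.2 h2)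
  rw [← ZMod.intCast_zmod_eq_zero_iff_dvd] at h3 ⊢
  push_cast at h3 ⊢
  rwa [ZMod.pow_card_pow] at h3

theorem IsPGroup.commute_pow_of_conj_eq_zpow (hG : IsPGroup p G) (hp : p.Prime) (hodd : Odd p)
    {c y : G} {a : ℤ} (h : y * c * y⁻¹ = c ^ a) (hy : Commute (y ^ p) c) :
    Commute y (c ^ p) := by
  by_cases hc : c = 1
  · simp [hc]
  obtain ⟨t, ht⟩ := exists_geom_sum_eq_mul_one_add_mul hodd (hG.dvd_sub_one_of_conj_eq_zpow hp h hc)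
  have h1 := pow_mul_zpow_mul_inv_of_conj_eq_zpow h p 1
  rw [zpow_one, hy.eq, mul_inv_cancel_right, one_mul] at h1
  have h2 : (c ^ ((p : ℤ) * (a - 1))) ^ (1 + p * t) = 1 := by
    have h3 : (p : ℤ) * (a - 1) * (1 + p * t) = a ^ p - 1 := by
      rw [← geom_sum_mul, ht]; ring
    rw [← zpow_mul, h3, zpow_sub, ← h1]
    simp
  have h4 := hG.eq_one_of_zpow_one_add_mul hp h2
  have h5 : y * c ^ p * y⁻¹ = c ^ p := by
    rw [← conj_pow, h, ← zpow_natCast, ← zpow_mul, ← zpow_natCast c, ← mul_inv_eq_one, ← zpow_neg,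
      ← zpow_add, ← h4]
    ring_nf
  exact mul_inv_eq_iff_eq_mul.1 h5

theorem Group.IsNilpotent.le_of_forall_mem_of_commutator_mem [Group.IsNilpotent G]
    {N K : Subgroup G} [N.Normal]
    (h : ∀ b ∈ N, (∀ g, b * g * b⁻¹ * g⁻¹ ∈ K) → b ∈ K) : N ≤ K := by
  have key : ∀ n, N ⊓ Subgroup.upperCentralSeries G n ≤ K := by
    intro n
    induction n with
    | zero => simp
    | succ n ih =>
      rintro b ⟨hbN, hb⟩
      refine h b hbN fun g => ih ⟨?_, (Subgroup.mem_upperCentralSeries_succ_iff.1 hb) g⟩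
      have h1 : g * b⁻¹ * g⁻¹ ∈ N := Subgroup.Normal.conj_mem ‹_› _ (N.inv_mem hbN) g
      simpa [mul_assoc] using N.mul_mem hbN h1
  obtain ⟨n, hn⟩ := Group.IsNilpotent.nilpotent (G := G)
  simpa [hn] using key n

theorem Subgroup.commutator_mem_iff_commute {K : Subgroup G} [K.Normal] {x y : G} :
    x * y * x⁻¹ * y⁻¹ ∈ K ↔ Commute (x : G ⧸ K) (y : G ⧸ K) := by
  rw [← QuotientGroup.eq_one_iff, QuotientGroup.mk_mul, QuotientGroup.mk_mul, QuotientGroup.mk_mul,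
    QuotientGroup.mk_inv, QuotientGroup.mk_inv, mul_inv_eq_one, mul_inv_eq_iff_eq_mul]
  rfl

theorem IsPGroup.exists_mem_notMem_of_not_le [Finite G] (hG : IsPGroup p G) (hp : p.Prime)
    {N K : Subgroup G} [N.Normal] [K.Normal] (hNK : ¬ N ≤ K) :
    ∃ b ∈ N, b ∉ K ∧ b ^ p ∈ K ∧ ∀ g, b * g * b⁻¹ * g⁻¹ ∈ K := by
  have := Fact.mk hp
  have := hG.isNilpotent
  obtain ⟨b, hbN, hbc, hbK⟩ : ∃ b ∈ N, (∀ g, b * g * b⁻¹ * g⁻¹ ∈ K) ∧ b ∉ K := by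
    by_contra! h
    exact hNK (Group.IsNilpotent.le_of_forall_mem_of_commutator_mem h)
  have hex : ∃ n, b ^ p ^ n ∈ K := by
    obtain ⟨n, hn⟩ := hG b
    exact ⟨n, hn ▸ K.one_mem⟩
  classical
  have hpos : Nat.find hex ≠ 0 := by
    intro h0
    have := Nat.find_spec hex
    rw [h0] at this
    simp at this
    exact hbK this
  obtain ⟨m, hm⟩ := Nat.exists_eq_succ_of_ne_zero hpos
  refine ⟨b ^ p ^ m, N.pow_mem hbN _, Nat.find_min hex (by omega), ?_, ?_⟩
  · have := Nat.find_spec hex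
    rwa [hm, Nat.succ_eq_add_one, pow_succ, pow_mul] at this
  · intro g
    rw [Subgroup.commutator_mem_iff_commute, QuotientGroup.mk_pow]
    exact (Subgroup.commutator_mem_iff_commute.1 (hbc g)).pow_left _

theorem IsPGroup.normal_of_isCoatom [Finite G] (hG : IsPGroup p G) (hp : p.Prime)
    {M : Subgroup G} (hM : IsCoatom M) : M.Normal := by
  have := Fact.mk hp
  have := hG.isNilpotent
  exact Subgroup.NormalizerCondition.normal_of_coatom M Group.normalizerCondition_of_isNilpotent hM

theorem IsPGroup.commutator_mem_and_pow_mem_frattini [Finite G] (hG : IsPGroup p G)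
    (hp : p.Prime) : (∀ x y : G, x * y * x⁻¹ * y⁻¹ ∈ frattini G) ∧ ∀ x : G, x ^ p ∈ frattini G := by
  have key : ∀ M : Subgroup G, IsCoatom M →
      (∀ x y : G, x * y * x⁻¹ * y⁻¹ ∈ M) ∧ ∀ x : G, x ^ p ∈ M := by
    intro M hM
    have hMn := hG.normal_of_isCoatom hp hM
    obtain ⟨b, -, hbM, hbp, hbc⟩ := hG.exists_mem_notMem_of_not_le hp (N := ⊤) (K := M)
      (fun h => hM.1 (top_le_iff.1 h))
    have top_of : ∀ L : Subgroup G, M ≤ L → b ∈ L → L = ⊤ := fun L hML hbL =>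
      hM.2 L (lt_of_le_of_ne hML fun h => hbM (h ▸ hbL))
    have hcomm : ∀ x y : G ⧸ M, x * y = y * x := by
      have h1 : (Subgroup.center (G ⧸ M)).comap (QuotientGroup.mk' M) = ⊤ := by
        refine top_of _ (fun m hm => ?_) ?_
        · rw [Subgroup.mem_comap, QuotientGroup.mk'_apply, (QuotientGroup.eq_one_iff m).2 hm]
          exact Subgroup.one_mem _
        · rw [Subgroup.mem_comap, Subgroup.mem_center_iff]
          intro g
          obtain ⟨g, rfl⟩ := QuotientGroup.mk_surjective g
          exact (Subgroup.commutator_mem_iff_commute.1 (hbc g)).eq.symm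
      intro x y
      obtain ⟨y, rfl⟩ := QuotientGroup.mk_surjective y
      have h2 : y ∈ (Subgroup.center (G ⧸ M)).comap (QuotientGroup.mk' M) := h1 ▸ Subgroup.mem_top y
      exact Subgroup.mem_center_iff.1 (Subgroup.mem_comap.1 h2) x
    refine ⟨fun x y => Subgroup.commutator_mem_iff_commute.2 (hcomm _ _), fun x => ?_⟩
    let P : Subgroup G :=
      { carrier := {x | x ^ p ∈ M}
        one_mem' := by simp [M.one_mem]
        mul_mem' := fun {x y} hx hy => by
          have h : Commute (x : G ⧸ M) (y : G ⧸ M) := hcomm _ _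
          simp only [Set.mem_ofPred_eq, ← QuotientGroup.eq_one_iff, QuotientGroup.mk_pow,
            QuotientGroup.mk_mul] at hx hy ⊢
          rw [h.mul_pow, hx, hy, one_mul]
        inv_mem' := fun {x} hx => by
          simp only [Set.mem_ofPred_eq, inv_pow] at hx ⊢
          exact M.inv_mem hx }
    have hP : P = ⊤ := top_of P (fun m hm => M.pow_mem hm p) hbp
    exact (hP ▸ Subgroup.mem_top x : x ∈ P)
  simp only [frattini, Order.radical, Subgroup.mem_iInf]
  exact ⟨fun x y M hM => (key M hM).1 x y, fun x M hM => (key M hM).2 x⟩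

theorem frattini_le_of_commutator_mem_of_pow_mem [Finite G] (hp : p.Prime) {K : Subgroup G}
    (hcomm : ∀ x y : G, x * y * x⁻¹ * y⁻¹ ∈ K) (hpow : ∀ x : G, x ^ p ∈ K) : frattini G ≤ K := by
  intro g hg
  by_contra hgK
  obtain ⟨M, hKM, hM⟩ := (Set.toFinite {L : Subgroup G | K ≤ L ∧ g ∉ L}).exists_le_maximal
    (a := K) ⟨le_rfl, hgK⟩
  refine hM.prop.2 (frattini_le_coatom ⟨by rintro rfl; exact hM.prop.2 (Subgroup.mem_top g), ?_⟩ hg)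
  intro L hML
  have hMn : M.Normal := ⟨fun m hm x => by
    simpa using M.mul_mem (hKM (hcomm x m)) hm⟩
  have mem_of : ∀ L, M < L → g ∈ L := fun L hL => by
    by_contra hgL
    exact hL.not_ge (hM.2 ⟨hKM.trans hL.le, hgL⟩ hL.le)
  rw [eq_top_iff]
  rintro x -
  by_cases hx : x ∈ M
  · exact hML.le hx
  have hgx : g ∈ M ⊔ Subgroup.zpowers x := mem_of _ <|
    lt_of_le_of_ne le_sup_left fun h => hx (h ▸ Subgroup.mem_sup_right (Subgroup.mem_zpowers x))
  obtain ⟨m, hm, y, hy, hmy⟩ := Subgroup.mem_sup_of_normal_left.1 hgx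
  obtain ⟨k, rfl⟩ := Subgroup.mem_zpowers_iff.1 hy
  refine Subgroup.mem_of_zpow_mem_of_pow_mem hp (k := k) ?_ ?_ (hML.le (hKM (hpow x)))
  · rintro ⟨j, rfl⟩
    refine hM.prop.2 (hmy ▸ M.mul_mem hm ?_)
    rw [zpow_mul, zpow_natCast]
    exact M.zpow_mem (hKM (hpow x)) _
  · rw [← inv_mul_eq_iff_eq_mul.2 hmy.symm]
    exact L.mul_mem (L.inv_mem (hML.le hm)) (mem_of L hML)

theorem Subgroup.zpowers_normal_of_forall_commute {x : G} (h : ∀ g, Commute g x) :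
    (Subgroup.zpowers x).Normal := ⟨fun y hy g => by
  obtain ⟨k, rfl⟩ := Subgroup.mem_zpowers_iff.1 hy
  rw [((h g).zpow_right k).eq, mul_inv_cancel_right]
  exact hy⟩

theorem Commute.of_mem_zpowers_right {g x y : G} (h : Commute g x) (hy : y ∈ Subgroup.zpowers x) :
    Commute g y := by
  obtain ⟨k, rfl⟩ := Subgroup.mem_zpowers_iff.1 hy
  exact h.zpow_right k

theorem IsPGroup.commute_of_frattini_eq_zpowers [Finite G] (hG : IsPGroup p G) (hp : p.Prime)
    (hodd : Odd p) {c : G} (hc : frattini G = Subgroup.zpowers c) (g : G) : Commute g c := by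
  by_cases hc1 : c = 1
  · simp [hc1]
  obtain ⟨hcomm, hpow⟩ := hG.commutator_mem_and_pow_mem_frattini hp
  have hconj : ∀ w, frattini G ≤ Subgroup.zpowers w → ∀ g,
      ∃ a : ℤ, g * w * g⁻¹ = w ^ a := by
    intro w hw g
    have h1 : g * w * g⁻¹ ∈ Subgroup.zpowers w := by
      simpa using Subgroup.mul_mem _ (hw (hcomm g w)) (Subgroup.mem_zpowers w)
    obtain ⟨a, ha⟩ := Subgroup.mem_zpowers_iff.1 h1
    exact ⟨a, ha.symm⟩
  -- `p`-th powers of generators of cyclic subgroups above the Frattini subgroup are central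
  have hcentral : ∀ w, frattini G ≤ Subgroup.zpowers w → ∀ g, Commute g (w ^ p) := by
    intro w hw g
    obtain ⟨a, ha⟩ := hconj w hw g
    exact hG.commute_pow_of_conj_eq_zpow hp hodd ha
      ((Commute.refl w).of_mem_zpowers_right (hw (hpow g))).symm
  have hgen : ∀ w ∈ frattini G, w ∉ Subgroup.zpowers (c ^ p) → c ∈ Subgroup.zpowers w := by
    intro w hw hwK
    rw [hc] at hw
    obtain ⟨k, rfl⟩ := Subgroup.mem_zpowers_iff.1 hw
    refine hG.mem_zpowers_zpow hp ?_ c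
    rintro ⟨j, rfl⟩
    exact hwK (Subgroup.mem_zpowers_iff.2 ⟨j, by rw [zpow_mul, zpow_natCast]⟩)
  have hcK : c ∉ Subgroup.zpowers (c ^ p) := by
    intro h
    obtain ⟨j, hj⟩ := Subgroup.mem_zpowers_iff.1 h
    refine hc1 (hG.eq_one_of_zpow_one_add_mul hp (t := -j) ?_)
    rw [zpow_add, zpow_one, mul_neg, zpow_neg, zpow_mul, zpow_natCast, hj, mul_inv_cancel]
  have hnot : ¬ frattini G ≤ Subgroup.zpowers (c ^ p) := fun h =>
    hcK (h (hc ▸ Subgroup.mem_zpowers c))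
  by_cases hpK : ∀ x : G, x ^ p ∈ Subgroup.zpowers (c ^ p)
  · obtain ⟨y, x, hyx⟩ : ∃ y x : G, y * x * y⁻¹ * x⁻¹ ∉ Subgroup.zpowers (c ^ p) := by
      by_contra! h
      exact hnot (frattini_le_of_commutator_mem_of_pow_mem hp h hpK)
    set w := y * x * y⁻¹ * x⁻¹ with hw
    have hcw := hgen w (hcomm y x) hyx
    have hΦ : frattini G ≤ Subgroup.zpowers w := by
      rw [hc]
      exact Subgroup.zpowers_le.2 hcw
    have hw1 : w ≠ 1 := fun h => hyx (h ▸ Subgroup.one_mem _)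
    obtain ⟨a, ha⟩ := hconj w hΦ x
    have hyxp : Commute y (x ^ p) :=
      (hcentral c hc.le y).of_mem_zpowers_right (hpK x)
    obtain ⟨t, ht⟩ := exists_geom_sum_eq_mul_one_add_mul hodd
      (hG.dvd_sub_one_of_conj_eq_zpow hp ha hw1)
    have h1 := zpow_mul_pow_of_conj_eq_zpow ha 1 p
    have h2 : (w ^ (1 : ℤ) * x) ^ p = x ^ p := by
      have h3 : w ^ (1 : ℤ) * x = y * x * y⁻¹ := by rw [hw]; group
      rw [h3, conj_pow, hyxp.eq, mul_inv_cancel_right]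
    rw [h2, one_mul, ht, right_eq_mul, zpow_mul] at h1
    have hwp := hG.eq_one_of_zpow_one_add_mul hp h1
    obtain ⟨b, hb⟩ := hconj w hΦ g
    obtain ⟨s, hs⟩ := hG.dvd_sub_one_of_conj_eq_zpow hp hb hw1
    have h4 : g * w * g⁻¹ = w := by
      rw [hb, show b = 1 + p * s by linarith, zpow_add, zpow_mul, hwp]
      simp
    exact Commute.of_mem_zpowers_right (mul_inv_eq_iff_eq_mul.1 h4) hcw
  · push Not at hpK
    obtain ⟨x, hx⟩ := hpK
    have hcx := hgen _ (hpow x) hx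
    refine (hcentral x ?_ g).of_mem_zpowers_right hcx
    rw [hc, Subgroup.zpowers_le]
    exact (Subgroup.zpowers_le.2 (Subgroup.pow_mem _ (Subgroup.mem_zpowers x) p)) hcx

/-- If the center has order `p` and contains all elements of order `p` of a normal subgroup `N` of
a finite `p`-group, `p` odd, then `N` is cyclic. -/
theorem IsPGroup.exists_eq_zpowers_of_forall_mem_center [Finite G] (hG : IsPGroup p G)
    (hp : p.Prime) (hodd : Odd p) (hZ : Nat.card (Subgroup.center G) = p) {N : Subgroup G}
    [N.Normal] (hN : ∀ x ∈ N, x ^ p = 1 → x ∈ Subgroup.center G) :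
    ∃ c, N = Subgroup.zpowers c := by
  have := Fact.mk hp
  obtain ⟨A, -, hA⟩ := (Set.toFinite
    {A : Subgroup G | A ≤ N ∧ A.Normal ∧ ∃ c, A = Subgroup.zpowers c}).exists_le_maximal
    (a := ⊥) ⟨bot_le, inferInstance, 1, by simp⟩
  obtain ⟨hAN, hAn, c, hAc⟩ := hA.prop
  by_contra hne
  have hNA : ¬ N ≤ A := fun h => hne ⟨c, (le_antisymm h hAN).trans hAc⟩
  -- a cyclic normal subgroup of `N` above `A` is `A`
  have hmax : ∀ b ∈ N, A ≤ Subgroup.zpowers b → (Subgroup.zpowers b).Normal → b ∈ A :=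
    fun b hbN hAb hbn => hA.2 ⟨Subgroup.zpowers_le.2 hbN, hbn, b, rfl⟩ hAb (Subgroup.mem_zpowers b)
  obtain ⟨b, hbN, hbA, hbp, hbc⟩ := hG.exists_mem_notMem_of_not_le hp hNA
  -- it suffices to find an element of order `p` outside `A`
  have key : ∀ d ∈ N, d ∉ A → d ^ p ≠ 1 := by
    intro d hdN hdA hdp
    have hdZ := hN d hdN hdp
    by_cases hc : c = 1
    · refine hdA (hmax d hdN (by simp [hAc, hc]) ?_)
      exact Subgroup.zpowers_normal_of_forall_commute fun g => Subgroup.mem_center_iff.1 hdZ g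
    · obtain ⟨n, hn⟩ := IsPGroup.iff_orderOf.1 hG c
      have hn0 : n ≠ 0 := by
        rintro rfl
        exact hc (by simpa using hn)
      obtain ⟨m, rfl⟩ := Nat.exists_eq_succ_of_ne_zero hn0
      have he1 : c ^ p ^ m ≠ 1 := pow_ne_one_of_lt_orderOf (pow_ne_zero _ hp.ne_zero)
        (hn ▸ Nat.pow_lt_pow_right hp.one_lt m.lt_succ_self)
      have heA : c ^ p ^ m ∈ A := hAc ▸ Subgroup.pow_mem _ (Subgroup.mem_zpowers c) _
      have heZ : c ^ p ^ m ∈ Subgroup.center G := by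
        refine hN _ (hAN heA) ?_
        rw [← pow_mul, ← pow_succ, ← Nat.succ_eq_add_one, ← hn, pow_orderOf_eq_one]
      obtain ⟨k, hk⟩ := mem_zpowers_of_prime_card hZ
        (g := (⟨_, heZ⟩ : Subgroup.center G)) (g' := ⟨d, hdZ⟩)
        (fun h => he1 (congrArg Subtype.val h))
      have hk' : (c ^ p ^ m) ^ k = d := congrArg Subtype.val hk
      exact hdA (hk' ▸ A.zpow_mem heA k)
  by_cases hc : c = 1
  · refine key b hbN hbA ?_
    rw [hAc, hc] at hbp
    simpa using hbp
  obtain ⟨j, hj⟩ := Subgroup.mem_zpowers_iff.1 (hAc ▸ hbp)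
  obtain ⟨a, ha⟩ := Subgroup.mem_zpowers_iff.1
    (hAc ▸ hAn.conj_mem c (hAc ▸ Subgroup.mem_zpowers c) b : b * c * b⁻¹ ∈ Subgroup.zpowers c)
  obtain ⟨t, ht⟩ := exists_geom_sum_eq_mul_one_add_mul hodd
    (hG.dvd_sub_one_of_conj_eq_zpow hp ha.symm hc)
  by_cases hpj : (p : ℤ) ∣ j
  · obtain ⟨i, rfl⟩ := hpj
    have h1 : c ∈ Subgroup.zpowers (c ^ (1 + p * t)) := by
      refine hG.mem_zpowers_zpow hp (fun h => ?_) c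
      exact (Nat.prime_iff_prime_int.1 hp).not_dvd_one ((dvd_add_left (dvd_mul_right _ _)).1 h)
    obtain ⟨k, hk⟩ := Subgroup.mem_zpowers_iff.1 (Subgroup.zpow_mem _ h1 (-i))
    have hcA : ∀ k : ℤ, c ^ k ∈ A := fun k => hAc ▸ Subgroup.zpow_mem _ (Subgroup.mem_zpowers c) k
    refine key (c ^ k * b) (N.mul_mem (hAN (hcA k)) hbN)
      (fun h => hbA ((A.mul_mem_cancel_left (hcA k)).1 h)) ?_
    rw [zpow_mul_pow_of_conj_eq_zpow ha.symm, ht, ← hj,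
      show k * ((p : ℤ) * (1 + p * t)) = (1 + p * t) * k * p by ring, zpow_mul, zpow_mul, hk,
      ← zpow_mul, ← zpow_add]
    simp [mul_comm]
  · have hcb : A ≤ Subgroup.zpowers b := by
      rw [hAc, Subgroup.zpowers_le]
      have h1 := hG.mem_zpowers_zpow hp hpj c
      rw [hj] at h1
      exact Subgroup.zpowers_le.2 (Subgroup.pow_mem _ (Subgroup.mem_zpowers b) p) h1
    refine hbA (hmax b hbN hcb ⟨fun y hy g => ?_⟩)
    obtain ⟨k, rfl⟩ := Subgroup.mem_zpowers_iff.1 hy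
    rw [← conj_zpow]
    refine Subgroup.zpow_mem _ ?_ k
    have h1 := hcb (A.inv_mem (hbc g))
    have h2 : g * b * g⁻¹ = (b * g * b⁻¹ * g⁻¹)⁻¹ * b := by group
    rw [h2]
    exact Subgroup.mul_mem _ h1 (Subgroup.mem_zpowers b)

theorem IsPGroup.mem_center_of_zpowers_normal (hG : IsPGroup p G) (hp : p.Prime) {x : G}
    (hx : x ^ p = 1) (hn : (Subgroup.zpowers x).Normal) : x ∈ Subgroup.center G := by
  by_cases hx1 : x = 1
  · exact hx1 ▸ Subgroup.one_mem _
  refine Subgroup.mem_center_iff.2 fun g => ?_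
  obtain ⟨a, ha⟩ := Subgroup.mem_zpowers_iff.1 (hn.conj_mem x (Subgroup.mem_zpowers x) g)
  obtain ⟨s, hs⟩ := hG.dvd_sub_one_of_conj_eq_zpow hp ha.symm hx1
  refine mul_inv_eq_iff_eq_mul.1 ?_
  rw [← ha, show a = 1 + p * s by linarith, zpow_add, zpow_mul, zpow_natCast, hx]
  simp

end PGroup

/-- A subgroup contained in the Frattini subgroup with an NRT isomorphic to an NRT of a normal
subgroup is itself normal. -/
theorem TransisoAdj.normal_of_le_frattini {G : Type*} [Group G] [Finite G] {H N : Subgroup G}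
    [N.Normal] (h : TransisoAdj H N) (hH : H ≤ frattini G) : H.Normal := by
  obtain ⟨S, T, ⟨hS1, hS⟩, ⟨hT1, hT⟩, φ, ⟨hφm, hφi, -⟩, hφ⟩ := h
  choose s hs hsu using hS
  simp only [and_imp] at hs hsu
  have hsS : ∀ g, s g ∈ S := fun g => (hs g).1
  have s_mul : ∀ k ∈ H, ∀ g, s (k * g) = s g := by
    intro k hk g
    obtain ⟨l, hl, hg⟩ := (hs g).2
    refine (hsu (k * g) (s g) (hsS g) ⟨k * l, H.mul_mem hk hl, ?_⟩).symm
    rw [mul_assoc, ← hg]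
  have s_self : ∀ x ∈ S, s x = x := fun x hx =>
    (hsu x x hx ⟨1, H.one_mem, by simp⟩).symm
  set ψ : G → G ⧸ N := fun g => (φ (s g) : G ⧸ N) with hψ
  have ψ_mul : ∀ g, ∀ x ∈ S, ψ (g * x) = ψ g * ψ x := by
    intro g x hx
    obtain ⟨l, hl, hg⟩ := (hs g).2
    have h1 : s (g * x) = s (s g * x) := by
      conv_lhs => rw [hg, mul_assoc]
      exact s_mul l hl _
    obtain ⟨n, hn, hmul⟩ := hφ (s g) (hsS g) x hx (s (s g * x)) (hsS _) (hs _).2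
    simp only [hψ]
    rw [h1, s_self x hx, ← QuotientGroup.mk_mul, hmul, QuotientGroup.mk_mul,
      (QuotientGroup.eq_one_iff n).2 hn, one_mul]
  have ψ_one : ψ 1 = 1 := by
    have := ψ_mul 1 1 hS1
    rwa [mul_one, left_eq_mul] at this
  have ψ_mul' : ∀ t ∈ Subgroup.closure S, ∀ g, ψ (g * t) = ψ g * ψ t := by
    intro t ht
    rw [← Subgroup.mem_toSubmonoid, Subgroup.closure_toSubmonoid_of_finite] at ht
    induction ht using Submonoid.closure_induction with
    | mem x hx => exact fun g => ψ_mul g x hx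
    | one => simp [ψ_one]
    | mul x y _ _ hx hy => exact fun g => by rw [← mul_assoc, hy, hx, hy, mul_assoc]
  have htop : Subgroup.closure S = ⊤ := by
    refine frattini_nongenerating (eq_top_iff.2 fun g _ => ?_)
    obtain ⟨l, hl, hg⟩ := (hs g).2
    rw [hg]
    exact Subgroup.mul_mem _ (Subgroup.mem_sup_right (hH hl))
      (Subgroup.mem_sup_left (Subgroup.subset_closure (hsS g)))
  let f : G →* G ⧸ N :=
    { toFun := ψ
      map_one' := ψ_one
      map_mul' := fun g t => ψ_mul' t (htop ▸ Subgroup.mem_top t) g }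
  have hker : f.ker = H := by
    ext g
    constructor
    · intro hg
      have h1 : φ (s g) ∈ N := (QuotientGroup.eq_one_iff _).1 hg
      have h2 : φ (s 1) ∈ N := (QuotientGroup.eq_one_iff _).1 ψ_one
      have h3 : φ (s g) = φ (s 1) := (hT 1).unique
        ⟨hφm (hsS g), _, N.inv_mem h1, by simp⟩ ⟨hφm (hsS 1), _, N.inv_mem h2, by simp⟩
      have h4 := hφi (hsS g) (hsS 1) h3
      obtain ⟨l, hl, hgl⟩ := (hs g).2
      rw [hgl, h4, s_self 1 hS1, mul_one]
      exact hl
    · intro hg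
      have h1 := s_mul g hg 1
      rw [mul_one] at h1
      change ψ g = 1
      rw [← ψ_one]
      simp only [hψ, h1]
  exact hker ▸ f.normal_ker

theorem stmt_13 {G : Type*} [Group G] (p : ℕ) (hp : p.Prime) (hodd : Odd p)
    (hcard : Nat.card G = p ^ 4 ∨ Nat.card G = p ^ 5)
    (hna : ¬ ∀ a b : G, a * b = b * a)
    (hnc : ∃ H : Subgroup G, Nat.card H = p ∧ ¬ H ≤ Subgroup.center G)
    (hZ : Nat.card (Subgroup.center G) = p)
    (hcomp : TransisoComplete G p) :
    frattini G = Subgroup.center G := by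
  have := Fact.mk hp
  have hG : IsPGroup p G := hcard.elim IsPGroup.of_card IsPGroup.of_card
  have : Finite G := Nat.finite_of_card_ne_zero <| by
    rcases hcard with h | h <;> simp [h, hp.ne_zero]
  have hΦ : ∀ x ∈ frattini G, x ^ p = 1 → x ∈ Subgroup.center G := by
    intro x hx hxp
    by_contra hxZ
    have hx1 : x ≠ 1 := fun h => hxZ (h ▸ Subgroup.one_mem _)
    have hadj := hcomp (Subgroup.zpowers x) (Subgroup.center G)
      ((Nat.card_zpowers x).trans (orderOf_eq_prime hxp hx1)) hZ
      (fun h => hxZ (h ▸ Subgroup.mem_zpowers x))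
    exact hxZ (hG.mem_center_of_zpowers_normal hp hxp
      (hadj.normal_of_le_frattini (Subgroup.zpowers_le.2 hx)))
  obtain ⟨c, hc⟩ := hG.exists_eq_zpowers_of_forall_mem_center hp hodd hZ hΦ
  have hle : frattini G ≤ Subgroup.center G := by
    rw [hc, Subgroup.zpowers_le]
    exact Subgroup.mem_center_iff.2 fun g => hG.commute_of_frattini_eq_zpowers hp hodd hc g
  have hne : frattini G ≠ ⊥ := by
    intro h
    refine hna fun a b => ?_
    have := (hG.commutator_mem_and_pow_mem_frattini hp).1 a b
    rwa [h, Subgroup.mem_bot, mul_inv_eq_one, mul_inv_eq_iff_eq_mul] at this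
  refine Subgroup.eq_of_le_of_card_ge hle ?_
  rw [hZ]
  have h1 : Nontrivial (frattini G) := (Subgroup.nontrivial_iff_ne_bot _).2 hne
  exact Nat.le_of_dvd Nat.card_pos
    ((hG.to_subgroup (frattini G)).card_eq_or_dvd.resolve_left Finite.one_lt_card.ne')
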